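/- If G is a connected d-regular nonbipartite graph of order n and diameter D, then the smallest adjacency eigenvalue satisfies μ_min(G) > 1/(nD) − d. -/

import Mathlib

open SimpleGraph Finset

/-- The adjacency matrix of a simple graph is Hermitian (it is a real symmetric matrix). -/
lemma adjMatrix_isHermitian {n : ℕ} (G : SimpleGraph (Fin n)) [DecidableRel G.Adj] :
    (G.adjMatrix ℝ).IsHermitian := by
  ext i j
  simp [Matrix.conjTranspose_apply, adj_comm]

/-- `specMax G` is `μ(G)`, the largest eigenvalue of the adjacency matrix of `G`. -/
noncomputable def specMax {n : ℕ} (G : SimpleGraph (Fin n)) [DecidableRel G.Adj] : ℝ :=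
  ⨆ i, (adjMatrix_isHermitian G).eigenvalues i

/-- `specMin G` is `μ_min(G)`, the smallest eigenvalue of the adjacency matrix of `G`. -/
noncomputable def specMin {n : ℕ} (G : SimpleGraph (Fin n)) [DecidableRel G.Adj] : ℝ :=
  ⨅ i, (adjMatrix_isHermitian G).eigenvalues i

/-- Every vertex of a connected graph is the end of a geodesic from `w`, whose `i`-th vertex is at
distance `i` from `w`. -/
lemma SimpleGraph.Connected.exists_geodesic {V : Type*} {G : SimpleGraph V} (hconn : G.Connected)
    (w u : V) : ∃ p : ℕ → V, p 0 = w ∧ p (G.dist w u) = u ∧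
      (∀ i < G.dist w u, G.Adj (p i) (p (i + 1))) ∧ ∀ i ≤ G.dist w u, G.dist w (p i) = i := by
  obtain ⟨q, hq⟩ := hconn.exists_walk_length_eq_dist w u
  refine ⟨q.getVert, q.getVert_zero, hq ▸ q.getVert_length,
    fun i hi => q.adj_getVert_succ (hq ▸ hi), fun i hi => ?_⟩
  have h₁ := dist_le (q.take i)
  have h₂ := dist_le (q.drop i)
  have h₃ := hconn.dist_triangle (u := w) (v := q.getVert i) (w := u)
  rw [Walk.take_length] at h₁
  rw [Walk.drop_length] at h₂
  omega

lemma sq_le_mul_sum_sq_sub_add_sq (m : ℕ) (a : ℕ → ℝ) :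
    a 0 ^ 2 ≤ (m + 1) * (∑ i ∈ range m, (a i - a (i + 1)) ^ 2 + a m ^ 2) := by
  induction m generalizing a with
  | zero => simp
  | succ m ih =>
    have h := ih fun i => a (i + 1)
    rw [sum_range_succ']
    simp only [zero_add] at h ⊢
    set T := ∑ i ∈ range m, (a (i + 1) - a (i + 1 + 1)) ^ 2 + a (m + 1) ^ 2 with hT
    have hm : (0 : ℝ) < m + 1 := by positivity
    have key : 0 ≤ (m + 1 : ℝ) * ((m + 1 + 1) * (T + (a 0 - a 1) ^ 2) - a 0 ^ 2) := by
      nlinarith [sq_nonneg ((m + 1 : ℝ) * (a 0 - a 1) - a 1)]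
    have := nonneg_of_mul_nonneg_right key hm
    push_cast
    linarith

/-- For a level function `t`, the edges between consecutive levels below `k` and an edge not
going below level `k` are distinct, so their total weight is at most half the sum of a symmetric
nonnegative weight over all ordered pairs. -/
lemma two_mul_sum_levels_add_le {V : Type*} [Fintype V] [DecidableEq V] (t : V → ℕ)
    {F : V → V → ℝ} (hF : ∀ a b, 0 ≤ F a b) (hsymm : ∀ a b, F a b = F b a) {u v : V}
    (huv : u ≠ v) {k : ℕ} (hu : k ≤ t u) (hv : k ≤ t v) :
    2 * (∑ i ∈ range k, ∑ e : V × V with t e.1 = i ∧ t e.2 = i + 1, F e.1 e.2 + F u v) ≤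
      ∑ e : V × V, F e.1 e.2 := by
  let c : V × V → ℝ := fun e => if t e.1 < k ∧ t e.2 = t e.1 + 1 then F e.1 e.2 else 0
  have hc : ∑ i ∈ range k, ∑ e : V × V with t e.1 = i ∧ t e.2 = i + 1, F e.1 e.2 = ∑ e, c e := by
    simp only [sum_filter]
    rw [sum_comm]
    refine sum_congr rfl fun e _ => ?_
    have : ∀ i, (t e.1 = i ∧ t e.2 = i + 1) ↔ (t e.1 = i ∧ t e.2 = t e.1 + 1) := by
      intro i; constructor <;> rintro ⟨rfl, h⟩ <;> exact ⟨rfl, h⟩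
    simp only [this, ite_and, sum_ite_eq, mem_range, c]
  have hswap : ∑ e : V × V, c e.swap = ∑ e, c e := Equiv.sum_comp (Equiv.prodComm V V) c
  have hsingle : ∀ a b, ∑ e : V × V, (if e = (a, b) then F e.1 e.2 else 0) = F a b := by
    intro a b; simp
  have hle : ∑ e : V × V, (c e + c e.swap + (if e = (u, v) then F e.1 e.2 else 0) +
      (if e = (v, u) then F e.1 e.2 else 0)) ≤ ∑ e : V × V, F e.1 e.2 := by
    refine sum_le_sum fun e _ => ?_
    obtain ⟨a, b⟩ := e
    have h₀ := hF a b
    have h₁ := hsymm a b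
    simp only [c, Prod.swap_prod_mk, Prod.mk.injEq]
    by_cases h₂ : a = u ∧ b = v
    · obtain ⟨rfl, rfl⟩ := h₂
      simp [huv, hu.not_gt, hv.not_gt]
    · by_cases h₃ : a = v ∧ b = u
      · obtain ⟨rfl, rfl⟩ := h₃
        simp [huv.symm, hu.not_gt, hv.not_gt]
      · simp only [h₂, h₃, if_false]
        split_ifs with h₄ h₅
        · omega
        all_goals linarith
  simp only [sum_add_distrib, hswap, hsingle] at hle
  rw [hc]
  linarith [hsymm u v]

/-- A Dirichlet energy estimate: if the edge weights `F` dominate the squared differences of `y`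
and the edge `uv` has weight at least `y u ^ 2 + y v ^ 2`, then the total weight of the edges is at
least `y w ^ 2 / D`, where `D` bounds the distances from `w`. -/
lemma SimpleGraph.Connected.two_mul_sq_le_mul_sum {V : Type*} [Fintype V] {G : SimpleGraph V}
    (hconn : G.Connected) {F : V → V → ℝ} (hF : ∀ a b, 0 ≤ F a b)
    (hsymm : ∀ a b, F a b = F b a) {y : V → ℝ}
    (hy : ∀ a b, G.Adj a b → (y a - y b) ^ 2 ≤ F a b) {u v : V} (huv : G.Adj u v)
    (hFuv : y u ^ 2 + y v ^ 2 ≤ F u v) {w : V} {D : ℕ} (hD : ∀ a, G.dist w a ≤ D)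
    (hD₀ : D ≠ 0) :
    2 * y w ^ 2 ≤ D * ∑ e : V × V, F e.1 e.2 := by
  classical
  wlog hle : G.dist w u ≤ G.dist w v generalizing u v
  · exact this huv.symm (by rw [hsymm, add_comm]; exact hFuv) (le_of_not_ge hle)
  obtain ⟨p, hp₀, hpu, hpadj, hpd⟩ := hconn.exists_geodesic w u
  have hsum := two_mul_sum_levels_add_le (G.dist w) hF hsymm huv.ne le_rfl hle
  have hS : 0 ≤ ∑ e : V × V, F e.1 e.2 := sum_nonneg fun e _ => hF _ _
  obtain hlt | heq := (hD u).lt_or_eq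
  · have hseq := sq_le_mul_sum_sq_sub_add_sq (G.dist w u) fun i => y (p i)
    simp only [hp₀, hpu] at hseq
    have hlev : ∑ i ∈ range (G.dist w u), (y (p i) - y (p (i + 1))) ^ 2 ≤
        ∑ i ∈ range (G.dist w u),
          ∑ e : V × V with G.dist w e.1 = i ∧ G.dist w e.2 = i + 1, F e.1 e.2 := by
      refine sum_le_sum fun i hi => ?_
      rw [mem_range] at hi
      refine (hy _ _ (hpadj i hi)).trans ?_
      exact single_le_sum (f := fun e : V × V => F e.1 e.2) (fun e _ => hF _ _)
        (by simp [hpd i hi.le, hpd (i + 1) hi] : (p i, p (i + 1)) ∈ _)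
    have hk : (G.dist w u + 1 : ℝ) ≤ D := by exact_mod_cast hlt
    calc 2 * y w ^ 2 ≤ (G.dist w u + 1 : ℝ) * ∑ e : V × V, F e.1 e.2 := by
          have h : (G.dist w u + 1 : ℝ) * (∑ i ∈ range (G.dist w u),
              (y (p i) - y (p (i + 1))) ^ 2 + y u ^ 2) ≤
              (G.dist w u + 1 : ℝ) * ((∑ e : V × V, F e.1 e.2) / 2) := by
            gcongr
            nlinarith [sq_nonneg (y v)]
          linarith
      _ ≤ D * ∑ e : V × V, F e.1 e.2 := by gcongr
  · have heqv : G.dist w v = D := le_antisymm (hD v) (heq ▸ hle)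
    obtain ⟨q, hq₀, hqv, hqadj, hqd⟩ := hconn.exists_geodesic w v
    rw [heq] at hpu hpadj hpd hsum
    rw [heqv] at hqv hqadj hqd
    obtain ⟨m, rfl⟩ := Nat.exists_eq_succ_of_ne_zero hD₀
    rw [Nat.succ_eq_add_one] at *
    have hseq := sq_le_mul_sum_sq_sub_add_sq m fun i => (y (p i) + y (q i)) / 2
    simp only [hp₀, hq₀, add_self_div_two] at hseq
    rw [sum_range_succ] at hsum
    have hlev : ∑ i ∈ range m,
          ((y (p i) + y (q i)) / 2 - (y (p (i + 1)) + y (q (i + 1))) / 2) ^ 2 ≤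
        ∑ i ∈ range m,
          ∑ e : V × V with G.dist w e.1 = i ∧ G.dist w e.2 = i + 1, F e.1 e.2 := by
      refine sum_le_sum fun i hi => ?_
      rw [mem_range] at hi
      have h₁ := single_le_sum (f := fun e : V × V => F e.1 e.2)
        (s := {e : V × V | G.dist w e.1 = i ∧ G.dist w e.2 = i + 1}) (fun e _ => hF _ _)
        (by simp [hpd i (by omega), hpd (i + 1) (by omega)] : (p i, p (i + 1)) ∈ _)
      have h₂ := single_le_sum (f := fun e : V × V => F e.1 e.2)
        (s := {e : V × V | G.dist w e.1 = i ∧ G.dist w e.2 = i + 1}) (fun e _ => hF _ _)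
        (by simp [hqd i (by omega), hqd (i + 1) (by omega)] : (q i, q (i + 1)) ∈ _)
      have h₃ := hy _ _ (hpadj i (by omega))
      have h₄ := hy _ _ (hqadj i (by omega))
      simp only at h₁ h₂
      nlinarith [sq_nonneg ((y (p i) - y (p (i + 1))) - (y (q i) - y (q (i + 1))))]
    have hlast : (y (p m) - y u) ^ 2 + (y (q m) - y v) ^ 2 ≤
        ∑ e : V × V with G.dist w e.1 = m ∧ G.dist w e.2 = m + 1, F e.1 e.2 := by
      have hne : (p m, u) ≠ (q m, v) := fun h => huv.ne (congrArg Prod.snd h)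
      have h₁ := hy _ _ (hpadj m (by omega))
      have h₂ := hy _ _ (hqadj m (by omega))
      rw [hpu] at h₁
      rw [hqv] at h₂
      refine (add_le_add h₁ h₂).trans ?_
      rw [← sum_pair (f := fun e : V × V => F e.1 e.2) hne]
      refine sum_le_sum_of_subset_of_nonneg ?_ fun e _ _ => hF _ _
      simp [insert_subset_iff, hpd m (by omega), hqd m (by omega), heq, heqv]
    have hbound : ∑ i ∈ range m,
        ((y (p i) + y (q i)) / 2 - (y (p (i + 1)) + y (q (i + 1))) / 2) ^ 2 +
          ((y (p m) + y (q m)) / 2) ^ 2 ≤ (∑ e : V × V, F e.1 e.2) / 2 := by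
      nlinarith [sq_nonneg (y (p m) - 2 * y u), sq_nonneg (y (q m) - 2 * y v),
        sq_nonneg (y (p m) - y (q m))]
    have := mul_le_mul_of_nonneg_left hbound (by positivity : (0 : ℝ) ≤ m + 1)
    push_cast
    linarith

/-- The quadratic form of the signless Laplacian of a regular graph. -/
lemma SimpleGraph.IsRegularOfDegree.sum_adj_sq_add {V : Type*} [Fintype V] [DecidableEq V]
    {G : SimpleGraph V} [DecidableRel G.Adj] {d : ℕ} (hreg : G.IsRegularOfDegree d) {x : V → ℝ}
    {μ : ℝ} (hx : (G.adjMatrix ℝ).mulVec x = μ • x) :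
    ∑ e : V × V, (if G.Adj e.1 e.2 then (x e.1 + x e.2) ^ 2 else 0) =
      2 * (d + μ) * ∑ a, x a ^ 2 := by
  have hcross : ∀ a, ∑ b, (if G.Adj a b then x b else 0) = μ * x a := fun a => by
    have := congrFun hx a
    rwa [adjMatrix_mulVec_apply, neighborFinset_eq_filter, sum_filter] at this
  have hdeg : ∀ a, ∑ b, (if G.Adj a b then (1 : ℝ) else 0) = d := fun a => by
    rw [← hreg a, ← card_neighborFinset_eq_degree, neighborFinset_eq_filter, sum_boole]
  have hsplit : ∀ a b, (if G.Adj a b then (x a + x b) ^ 2 else 0) =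
      x a ^ 2 * (if G.Adj a b then 1 else 0) + 2 * x a * (if G.Adj a b then x b else 0) +
        x b ^ 2 * (if G.Adj b a then 1 else 0) := fun a b => by
    simp only [G.adj_comm b a]
    split_ifs <;> ring
  have hcomm : ∑ a, ∑ b, x b ^ 2 * (if G.Adj b a then (1 : ℝ) else 0) = ∑ a, x a ^ 2 * d := by
    rw [sum_comm]
    simp only [← mul_sum, hdeg]
  rw [Fintype.sum_prod_type]
  simp only [hsplit, sum_add_distrib, hcomm, ← mul_sum, hdeg, hcross]
  rw [← sum_add_distrib, ← sum_add_distrib, mul_sum]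
  exact sum_congr rfl fun a _ => by ring

/-- In a nonbipartite graph, every real function has an edge whose ends have the same sign. -/
lemma SimpleGraph.exists_adj_mul_nonneg {V : Type*} {G : SimpleGraph V} (hnb : ¬ G.Colorable 2)
    (x : V → ℝ) : ∃ u v, G.Adj u v ∧ 0 ≤ x u * x v := by
  by_contra! h
  refine hnb ⟨Coloring.mk (fun a => if x a < 0 then 0 else 1) fun {a b} hab heq => ?_⟩
  have := h a b hab
  split_ifs at heq with h₁ h₂
  · nlinarith
  · simp at heq
  · simp at heq
  · nlinarith

/-- If `G` is a connected `d`-regular nonbipartite graph of order `n` and diameter `D`, then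
the smallest adjacency eigenvalue satisfies `μ_min(G) > 1/(nD) − d`. -/
theorem specMin_gt_of_regular_nonbipartite {n d D : ℕ}
    (G : SimpleGraph (Fin n)) [DecidableRel G.Adj]
    (hreg : G.IsRegularOfDegree d) (hconn : G.Connected) (hD : G.diam = D)
    (hnb : ¬ G.Colorable 2) :
    specMin G > 1 / (n * D) - d := by
  have := hconn.nonempty
  obtain ⟨j, hj⟩ := exists_eq_ciInf_of_finite (f := (adjMatrix_isHermitian G).eigenvalues)
  set μ := (adjMatrix_isHermitian G).eigenvalues j
  have hspec : specMin G = μ := hj.symm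
  let x : Fin n → ℝ := ⇑((adjMatrix_isHermitian G).eigenvectorBasis j)
  have hx : (G.adjMatrix ℝ).mulVec x = μ • x := (adjMatrix_isHermitian G).mulVec_eigenvectorBasis j
  have hnorm : ∑ a, x a ^ 2 = 1 := by
    have h := (adjMatrix_isHermitian G).eigenvectorBasis.orthonormal.1 j
    rw [EuclideanSpace.norm_eq, Real.sqrt_eq_one] at h
    simpa using h
  have henergy := hreg.sum_adj_sq_add hx
  rw [hnorm, mul_one] at henergy
  obtain ⟨u, v, huv, hxuv⟩ := exists_adj_mul_nonneg hnb x
  obtain ⟨w, hw⟩ := Finite.exists_max fun a => |x a|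
  have hdist : ∀ a b, G.dist a b ≤ D := fun a b =>
    hD ▸ dist_le_diam (connected_iff_ediam_ne_top.mp hconn)
  have hD₀ : D ≠ 0 := by
    have := hdist u v
    rw [dist_eq_one_iff_adj.mpr huv] at this
    omega
  let F : Fin n → Fin n → ℝ := fun a b => if G.Adj a b then (x a + x b) ^ 2 else 0
  have hF : ∀ a b, 0 ≤ F a b := fun a b => by
    simp only [F]; split_ifs <;> positivity
  have hFsymm : ∀ a b, F a b = F b a := fun a b => by
    simp only [F, G.adj_comm b a, add_comm (x b)]
  have hFdiff : ∀ a b, G.Adj a b → (|x a| - |x b|) ^ 2 ≤ F a b := fun a b hab => by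
    simp only [F, if_pos hab]
    nlinarith [sq_abs (x a), sq_abs (x b), neg_abs_le (x a * x b), abs_mul (x a) (x b)]
  have hFuv : |x u| ^ 2 + |x v| ^ 2 ≤ F u v := by
    simp only [F, if_pos huv, sq_abs]
    nlinarith
  have hmain := hconn.two_mul_sq_le_mul_sum hF hFsymm hFdiff huv hFuv (hdist w) hD₀
  have hDpos : (0 : ℝ) < D := by exact_mod_cast Nat.pos_of_ne_zero hD₀
  have hnpos : (0 : ℝ) < n := by exact_mod_cast Fin.pos w
  simp only [F, henergy, sq_abs] at hmain
  have hsq : ∀ a, x a ^ 2 ≤ x w ^ 2 := fun a => sq_le_sq.mpr (hw a)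
  have hnw : 1 ≤ n * x w ^ 2 := by
    simpa [hnorm] using sum_le_card_nsmul univ _ _ fun a _ => hsq a
  rw [hspec, gt_iff_lt, sub_lt_iff_lt_add, div_lt_iff₀ (by positivity)]
  by_contra! hle
  have hnw' : n * x w ^ 2 ≤ 1 := by
    have := mul_le_mul_of_nonneg_left hmain hnpos.le
    linarith
  have hconst : ∀ a, x a ^ 2 = x w ^ 2 := by
    have h : ∑ a, (x w ^ 2 - x a ^ 2) = 0 := by
      rw [sum_sub_distrib, hnorm]
      simp
      linarith
    intro a
    have := (sum_eq_zero_iff_of_nonneg fun a _ => sub_nonneg.mpr (hsq a)).mp h a (mem_univ a)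
    linarith
  have hedge : 2 * F u v ≤ 2 * (d + μ) := by
    rw [← henergy]
    simpa using two_mul_sum_levels_add_le (fun _ => 0) hF hFsymm huv.ne (k := 0) le_rfl le_rfl
  simp only [F, if_pos huv] at hedge
  have hlow : 2 * x w ^ 2 ≤ d + μ := by
    nlinarith [hconst u, hconst v]
  have hD₁ : (1 : ℝ) ≤ D := by exact_mod_cast Nat.one_le_iff_ne_zero.mpr hD₀
  nlinarith [mul_le_mul hD₁ (mul_le_mul_of_nonneg_left hlow hnpos.le) (by positivity) hDpos.le]
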